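/- Entropy-production identity for the alternative dissipative bracket (Remark after Theorem 1): Let f : ℝ² → ℝ be smooth with f(x) > 0 for all x, let μ : ℝ² → ℝ be smooth and compactly supported, and let e : ℝ² → ℝ be smooth. Then ∫_{ℝ²} [μ, log∘f](x)·[f, e](x) dx = ∫_{ℝ²} (μ(x)/f(x))·[f, [f, e]](x) dx. (This identity shows that under the alternative variational choice, the entropy dynamics dS/dt = −⟨μ/f, [f,[f, δE/δf]]⟩ need not vanish, in contrast with the reversible bracket of equation (3).) -/

import Mathlib

/-- Partial derivative with respect to the first coordinate `q` on phase space `ℝ × ℝ`. -/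
noncomputable def pdq (f : ℝ × ℝ → ℝ) (x : ℝ × ℝ) : ℝ :=
  deriv (fun q => f (q, x.2)) x.1

/-- Partial derivative with respect to the second coordinate `p` on phase space `ℝ × ℝ`. -/
noncomputable def pdp (f : ℝ × ℝ → ℝ) (x : ℝ × ℝ) : ℝ :=
  deriv (fun p => f (x.1, p)) x.2

/-- Canonical Poisson bracket `[f,g] = ∂f/∂q·∂g/∂p − ∂f/∂p·∂g/∂q` on `ℝ × ℝ`. -/
noncomputable def pb (f g : ℝ × ℝ → ℝ) (x : ℝ × ℝ) : ℝ :=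
  pdq f x * pdp g x - pdp f x * pdq g x

open MeasureTheory

theorem pdq_eq_fderiv {f : ℝ × ℝ → ℝ} (hf : Differentiable ℝ f) :
    pdq f = fun x => fderiv ℝ f x (1, 0) := by
  funext x
  have h : HasDerivAt (fun q : ℝ => (q, x.2)) ((1 : ℝ), (0 : ℝ)) x.1 :=
    (hasDerivAt_id x.1).prodMk (hasDerivAt_const x.1 x.2)
  exact ((hf x).hasFDerivAt.comp_hasDerivAt x.1 h).deriv

theorem pdp_eq_fderiv {f : ℝ × ℝ → ℝ} (hf : Differentiable ℝ f) :
    pdp f = fun x => fderiv ℝ f x (0, 1) := by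
  funext x
  have h : HasDerivAt (fun p : ℝ => (x.1, p)) ((0 : ℝ), (1 : ℝ)) x.2 :=
    (hasDerivAt_const x.2 x.1).prodMk (hasDerivAt_id x.2)
  exact ((hf x).hasFDerivAt.comp_hasDerivAt x.2 h).deriv

theorem pb_eq_fderiv {f g : ℝ × ℝ → ℝ} (hf : Differentiable ℝ f) (hg : Differentiable ℝ g) :
    pb f g = fun x => fderiv ℝ f x (1, 0) * fderiv ℝ g x (0, 1)
      - fderiv ℝ f x (0, 1) * fderiv ℝ g x (1, 0) := by
  funext x
  rw [pb, pdq_eq_fderiv hf, pdq_eq_fderiv hg, pdp_eq_fderiv hf, pdp_eq_fderiv hg]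

section Smooth

variable {f g : ℝ × ℝ → ℝ}

theorem ContDiff.fderiv_smooth_apply_const (hf : ContDiff ℝ (⊤ : ℕ∞) f) (v : ℝ × ℝ) :
    ContDiff ℝ (⊤ : ℕ∞) (fun x => fderiv ℝ f x v) :=
  (hf.fderiv_right (m := (⊤ : ℕ∞)) (by simp)).clm_apply contDiff_const

theorem ContDiff.differentiable_of_smooth (hf : ContDiff ℝ (⊤ : ℕ∞) f) : Differentiable ℝ f :=
  hf.differentiable (by simp)

theorem contDiff_pb (hf : ContDiff ℝ (⊤ : ℕ∞) f) (hg : ContDiff ℝ (⊤ : ℕ∞) g) :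
    ContDiff ℝ (⊤ : ℕ∞) (pb f g) := by
  rw [pb_eq_fderiv hf.differentiable_of_smooth hg.differentiable_of_smooth]
  exact ((hf.fderiv_smooth_apply_const _).mul (hg.fderiv_smooth_apply_const _)).sub
    ((hf.fderiv_smooth_apply_const _).mul (hg.fderiv_smooth_apply_const _))

theorem hasCompactSupport_pb_left (hf : ContDiff ℝ (⊤ : ℕ∞) f) (hg : ContDiff ℝ (⊤ : ℕ∞) g)
    (hfc : HasCompactSupport f) : HasCompactSupport (pb f g) := by
  rw [pb_eq_fderiv hf.differentiable_of_smooth hg.differentiable_of_smooth]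
  exact (hfc.fderiv_apply ℝ _).mul_right.sub (hfc.fderiv_apply ℝ _).mul_right

theorem integral_fderiv_mul_eq_neg (hf : ContDiff ℝ (⊤ : ℕ∞) f) (hg : ContDiff ℝ (⊤ : ℕ∞) g)
    (hfc : HasCompactSupport f) (v : ℝ × ℝ) :
    ∫ x, fderiv ℝ f x v * g x = -∫ x, f x * fderiv ℝ g x v := by
  rw [integral_mul_fderiv_eq_neg_fderiv_mul_of_integrable, neg_neg]
  · exact ((hf.fderiv_smooth_apply_const v).continuous.mul
      hg.continuous).integrable_of_hasCompactSupport (hfc.fderiv_apply ℝ v).mul_right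
  · exact (hf.continuous.mul
      (hg.fderiv_smooth_apply_const v).continuous).integrable_of_hasCompactSupport hfc.mul_right
  · exact (hf.continuous.mul hg.continuous).integrable_of_hasCompactSupport hfc.mul_right
  · exact fun x _ => hf.differentiable_of_smooth x
  · exact fun x _ => hg.differentiable_of_smooth x

theorem fderiv_fderiv_apply_comm (hg : ContDiff ℝ (⊤ : ℕ∞) g) (x v w : ℝ × ℝ) :
    fderiv ℝ (fun y => fderiv ℝ g y v) x w = fderiv ℝ (fun y => fderiv ℝ g y w) x v := by
  have hd : DifferentiableAt ℝ (fderiv ℝ g) x :=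
    (hg.fderiv_right (m := (⊤ : ℕ∞)) (by simp)).differentiable (by simp) x
  have happ (u : ℝ × ℝ) : fderiv ℝ (fun y => fderiv ℝ g y u) x
      = (fderiv ℝ (fderiv ℝ g) x).flip u := by
    simpa using fderiv_clm_apply hd (differentiableAt_const u)
  have hsymm : IsSymmSndFDerivAt ℝ g x := hg.contDiffAt.isSymmSndFDerivAt (by simpa using WithTop.coe_le_coe.mpr (le_top (a := (2 : ℕ∞))))
  simpa [happ] using hsymm w v

/-- The Poisson bracket of a compactly supported function with any smooth function has
vanishing integral. -/
theorem integral_pb_eq_zero (hf : ContDiff ℝ (⊤ : ℕ∞) f) (hg : ContDiff ℝ (⊤ : ℕ∞) g)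
    (hfc : HasCompactSupport f) : ∫ x, pb f g x = 0 := by
  have hint (v w : ℝ × ℝ) : Integrable (fun x => fderiv ℝ f x v * fderiv ℝ g x w) :=
    ((hf.fderiv_smooth_apply_const v).continuous.mul
      (hg.fderiv_smooth_apply_const w).continuous).integrable_of_hasCompactSupport
      (hfc.fderiv_apply ℝ v).mul_right
  rw [pb_eq_fderiv hf.differentiable_of_smooth hg.differentiable_of_smooth,
    integral_sub (hint _ _) (hint _ _),
    integral_fderiv_mul_eq_neg hf (hg.fderiv_smooth_apply_const _) hfc,
    integral_fderiv_mul_eq_neg hf (hg.fderiv_smooth_apply_const _) hfc]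
  simp_rw [fderiv_fderiv_apply_comm hg _ (0, 1) (1, 0)]
  exact sub_self _

end Smooth

theorem pb_mul_left {f g h : ℝ × ℝ → ℝ} (hf : Differentiable ℝ f) (hg : Differentiable ℝ g)
    (hh : Differentiable ℝ h) (x : ℝ × ℝ) :
    pb (fun y => f y * g y) h x = f x * pb g h x + pb f h x * g x := by
  rw [pb_eq_fderiv (hf.fun_mul hg) hh, pb_eq_fderiv hg hh, pb_eq_fderiv hf hh]
  simp only [fderiv_fun_mul (hf x) (hg x), add_apply,
    smul_apply, smul_eq_mul]
  ring

theorem pb_log_right {f g : ℝ × ℝ → ℝ} (hf : Differentiable ℝ f) (hg : Differentiable ℝ g)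
    (hf0 : ∀ x, f x ≠ 0) (x : ℝ × ℝ) :
    pb g (fun y => Real.log (f y)) x = -(pb f g x / f x) := by
  rw [pb_eq_fderiv hg (hf.log hf0), pb_eq_fderiv hf hg]
  simp only [fderiv.log (hf x) (hf0 x), smul_apply, smul_eq_mul]
  ring

/-- Entropy-production identity for the alternative dissipative bracket:
`∫ [μ, log f]·[f, e] = ∫ (μ/f)·[f,[f,e]]` for smooth positive `f`, smooth compactly
supported `μ`, and smooth `e`. -/
theorem entropy_production_identity (f μ e : ℝ × ℝ → ℝ)
    (hf : ContDiff ℝ (⊤ : ℕ∞) f) (hfpos : ∀ x : ℝ × ℝ, 0 < f x)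
    (hμ : ContDiff ℝ (⊤ : ℕ∞) μ) (hμc : HasCompactSupport μ)
    (he : ContDiff ℝ (⊤ : ℕ∞) e) :
    ∫ x : ℝ × ℝ, pb μ (fun y => Real.log (f y)) x * pb f e x
      = ∫ x : ℝ × ℝ, (μ x / f x) * pb f (pb f e) x := by
  have hf0 (x : ℝ × ℝ) : f x ≠ 0 := (hfpos x).ne'
  have hlog : ContDiff ℝ (⊤ : ℕ∞) (fun y => Real.log (f y)) := hf.log hf0
  have hh : ContDiff ℝ (⊤ : ℕ∞) (pb f e) := contDiff_pb hf he
  have hzero := integral_pb_eq_zero (hμ.mul hh) hlog hμc.mul_right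
  have hsplit (x : ℝ × ℝ) : pb (fun y => μ y * pb f e y) (fun y => Real.log (f y)) x
      = pb μ (fun y => Real.log (f y)) x * pb f e x - (μ x / f x) * pb f (pb f e) x := by
    rw [pb_mul_left hμ.differentiable_of_smooth hh.differentiable_of_smooth
      hlog.differentiable_of_smooth,
      pb_log_right hf.differentiable_of_smooth hh.differentiable_of_smooth hf0]
    ring
  simp_rw [hsplit] at hzero
  rw [integral_sub] at hzero
  · exact sub_eq_zero.mp hzero
  · exact ((contDiff_pb hμ hlog).continuous.mul hh.continuous).integrable_of_hasCompactSupport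
      (hasCompactSupport_pb_left hμ hlog hμc).mul_right
  · refine ((hμ.continuous.div hf.continuous hf0).mul
      (contDiff_pb hf hh).continuous).integrable_of_hasCompactSupport
      (HasCompactSupport.mul_right ?_)
    simp_rw [div_eq_mul_inv]
    exact hμc.mul_right
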